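/- Let d ≥ 1 and α ∈ (d/2, d). There is a constant C depending only on d and α such that for all t ∈ (0,1] and u ∈ [0, 2t], the double sum over nonzero n¹, n² ∈ ℤ^d of e^(−π²|n¹+n²|²(2t−u)) · e^(−π²(|n¹|²+|n²|²)u) / (|n¹|^α |n²|^α) is at most C · t^(−(d−α)). -/

import Mathlib

/-- Squared Euclidean norm of a lattice point in `ℤ^d`. -/
noncomputable def znormSq {d : ℕ} (n : Fin d → ℤ) : ℝ := ∑ i, ((n i : ℝ)) ^ 2

/-- Euclidean norm of a lattice point in `ℤ^d`. -/
noncomputable def znorm {d : ℕ} (n : Fin d → ℤ) : ℝ := Real.sqrt (znormSq n)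

lemma step_neg (n γ : ℝ) (hn : 0 < n) (hγ : 1 < γ) :
    (γ - 1) * (n + 1) ^ (-γ) ≤ n ^ (1 - γ) - (n + 1) ^ (1 - γ) := by
  have h1 : (n + 1) ^ (-γ) = (n + 1) ^ (1 - γ) / (n + 1) := by
    rw [← Real.rpow_sub_one (by positivity)]; ring_nf
  have h2 : n ^ (1 - γ) = (n + 1) ^ (1 - γ) * (n / (n + 1)) ^ (1 - γ) := by
    rw [← Real.mul_rpow (by positivity) (by positivity)]
    congr 1; field_simp
  have h3 : 1 + (γ - 1) / (n + 1) ≤ (n / (n + 1)) ^ (1 - γ) := by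
    rw [Real.rpow_def_of_pos (by positivity)]
    have h4 := Real.add_one_le_exp (Real.log (n / (n + 1)) * (1 - γ))
    have h5 := Real.log_le_sub_one_of_pos (show 0 < n / (n + 1) by positivity)
    have h6 : n / (n + 1) - 1 = - (1 / (n + 1)) := by field_simp; ring
    have h7 : (γ - 1) / (n + 1) = (γ - 1) * (1 / (n + 1)) := by ring
    rw [h6] at h5
    rw [h7]
    nlinarith
  have h8 : 0 < (n + 1) ^ (1 - γ) := by positivity
  rw [h1, h2]
  have := mul_le_mul_of_nonneg_left h3 h8.le
  have e : (γ - 1) * ((n + 1) ^ (1 - γ) / (n + 1)) = (n + 1) ^ (1 - γ) * ((γ - 1) / (n + 1)) := by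
    ring
  rw [e]; linarith

lemma step_pos (n γ : ℝ) (hn : 0 ≤ n) (h0 : 0 < γ) (hγ : γ < 1) :
    (1 - γ) * (n + 1) ^ (-γ) ≤ (n + 1) ^ (1 - γ) - n ^ (1 - γ) := by
  have h1 : (n + 1) ^ (-γ) = (n + 1) ^ (1 - γ) / (n + 1) := by
    rw [← Real.rpow_sub_one (by positivity)]; ring_nf
  have h2 : n ^ (1 - γ) = (n + 1) ^ (1 - γ) * (1 + -(1 / (n + 1))) ^ (1 - γ) := by
    have : 1 + -(1 / (n + 1)) = n / (n + 1) := by field_simp; ring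
    rw [this, ← Real.mul_rpow (by positivity) (by positivity)]
    congr 1; field_simp
  have h3 := rpow_one_add_le_one_add_mul_self (s := -(1 / (n + 1))) (p := 1 - γ)
    (by rw [neg_le_neg_iff, div_le_one (by positivity)]; linarith) (by linarith) (by linarith)
  have h8 : 0 < (n + 1) ^ (1 - γ) := by positivity
  rw [h1, h2]
  have := mul_le_mul_of_nonneg_left h3 h8.le
  have e : (1 - γ) * ((n + 1) ^ (1 - γ) / (n + 1)) = (n + 1) ^ (1 - γ) * ((1 - γ) * (1 / (n + 1))) := by
    ring
  rw [e]; linarith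

/-- Partial sums of `n^{-γ}`, `γ<1`. -/
lemma sum_pos (γ : ℝ) (h0 : 0 < γ) (hγ : γ < 1) (M : ℕ) :
    ∑ n ∈ Finset.range M, ((n : ℝ) + 1) ^ (-γ) ≤ (M : ℝ) ^ (1 - γ) / (1 - γ) := by
  rw [le_div_iff₀ (by linarith)]
  induction M with
  | zero => simp; positivity
  | succ M ih =>
    rw [Finset.sum_range_succ]
    have := step_pos M γ (by positivity) h0 hγ
    push_cast
    linarith

lemma sum_neg (γ : ℝ) (hγ : 1 < γ) (N : ℕ) (hN : 0 < N) (M : ℕ) :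
    ∑ n ∈ Finset.range M, ((N : ℝ) + n + 1) ^ (-γ) ≤ (N : ℝ) ^ (1 - γ) / (γ - 1) := by
  rw [le_div_iff₀ (by linarith)]
  have : (∑ n ∈ Finset.range M, ((N : ℝ) + n + 1) ^ (-γ)) * (γ - 1)
      ≤ (N : ℝ) ^ (1 - γ) - ((N : ℝ) + M) ^ (1 - γ) := by
    induction M with
    | zero => simp
    | succ M ih =>
      rw [Finset.sum_range_succ]
      have := step_neg (N + M) γ (by positivity) hγ
      push_cast
      rw [← add_assoc]
      linarith
  have h : 0 ≤ ((N : ℝ) + M) ^ (1 - γ) := by positivity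
  linarith

/-- A finite sum over `ℤ` of an even function is bounded by twice a sum over `ℕ`. -/
lemma sum_int_le (f : ℕ → ℝ) (hf : ∀ n, 0 ≤ f n) (B : ℝ)
    (hB : ∀ M : ℕ, ∑ n ∈ Finset.range M, f n ≤ B) (s : Finset ℤ) :
    ∑ k ∈ s, f k.natAbs ≤ 2 * B := by
  obtain ⟨M, hM⟩ : ∃ M : ℕ, ∀ k ∈ s, k.natAbs < M :=
    ⟨s.sup Int.natAbs + 1, fun k hk => Nat.lt_succ_of_le (Finset.le_sup (f := Int.natAbs) hk)⟩
  rw [← Finset.sum_filter_add_sum_filter_not s (fun k => 0 ≤ k)]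
  have key : ∀ s' : Finset ℤ, s' ⊆ s → Set.InjOn Int.natAbs s' →
      ∑ k ∈ s', f k.natAbs ≤ B := by
    intro s' hs' hinj
    rw [← Finset.sum_image (f := f) (g := Int.natAbs) hinj]
    refine le_trans (Finset.sum_le_sum_of_subset_of_nonneg ?_ fun i _ _ => hf i) (hB M)
    intro n hn
    obtain ⟨k, hk, rfl⟩ := Finset.mem_image.1 hn
    exact Finset.mem_range.2 (hM k (hs' hk))
  have a := key (s.filter (fun k => 0 ≤ k)) (Finset.filter_subset _ _) (by
    intro x hx y hy h
    simp at hx hy h; omega)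
  have b := key (s.filter (fun k => ¬ 0 ≤ k)) (Finset.filter_subset _ _) (by
    intro x hx y hy h
    simp at hx hy h; omega)
  linarith

lemma natAbs_real (k : ℤ) : ((k.natAbs : ℕ) : ℝ) = |(k : ℝ)| := by
  rw [Nat.cast_natAbs]; simp

lemma one_dim_tail (γ : ℝ) (hγ : 1 < γ) : ∃ C : ℝ, 0 < C ∧ ∀ R : ℝ, 1 ≤ R → ∀ s : Finset ℤ,
    ∑ k ∈ s, (max R |(k : ℝ)|) ^ (-γ) ≤ C * R ^ (1 - γ) := by
  have hg : 0 < γ - 1 := by linarith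
  refine ⟨2 * (3 + 1 / (γ - 1)), by positivity, fun R hR s => ?_⟩
  have hR0 : 0 < R := by linarith
  have := sum_int_le (fun n => (max R (n : ℝ)) ^ (-γ)) (fun n => by positivity)
    ((3 + 1 / (γ - 1)) * R ^ (1 - γ)) ?_ s
  · simp only [natAbs_real] at this
    linarith
  intro M
  set N := ⌈R⌉₊ with hNdef
  have hN1 : R ≤ N := Nat.le_ceil R
  have hN2 : (N : ℝ) < R + 1 := Nat.ceil_lt_add_one hR0.le
  have hN : 0 < N := Nat.ceil_pos.2 hR0
  have h1 : ∑ n ∈ Finset.range M, (max R (n : ℝ)) ^ (-γ)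
      ≤ ∑ n ∈ Finset.range (N + 1 + M), (max R (n : ℝ)) ^ (-γ) :=
    Finset.sum_le_sum_of_subset_of_nonneg (Finset.range_mono (by omega))
      fun i _ _ => by positivity
  refine h1.trans ?_
  rw [Finset.sum_range_add]
  have h2 : ∑ n ∈ Finset.range (N + 1), (max R (n : ℝ)) ^ (-γ) ≤ 3 * R ^ (1 - γ) := by
    calc ∑ n ∈ Finset.range (N + 1), (max R (n : ℝ)) ^ (-γ)
        ≤ ∑ n ∈ Finset.range (N + 1), R ^ (-γ) := Finset.sum_le_sum fun i _ =>
          Real.rpow_le_rpow_of_nonpos hR0 (le_max_left _ _) (by linarith)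
      _ = (N + 1) * R ^ (-γ) := by simp
      _ ≤ (3 * R) * R ^ (-γ) := by gcongr; linarith
      _ = 3 * R ^ (1 - γ) := by
          rw [mul_assoc, sub_eq_add_neg, Real.rpow_add hR0, Real.rpow_one]
  have h3 : ∑ n ∈ Finset.range M, (max R ((N + 1 + n : ℕ) : ℝ)) ^ (-γ)
      ≤ 1 / (γ - 1) * R ^ (1 - γ) := by
    calc ∑ n ∈ Finset.range M, (max R ((N + 1 + n : ℕ) : ℝ)) ^ (-γ)
        ≤ ∑ n ∈ Finset.range M, ((N : ℝ) + n + 1) ^ (-γ) := Finset.sum_le_sum fun i _ => by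
          apply Real.rpow_le_rpow_of_nonpos (by positivity) _ (by linarith)
          refine le_trans (le_of_eq ?_) (le_max_right _ _)
          push_cast; ring
      _ ≤ (N : ℝ) ^ (1 - γ) / (γ - 1) := sum_neg γ hγ N hN M
      _ ≤ R ^ (1 - γ) / (γ - 1) := by
          gcongr ?_ / _
          exact Real.rpow_le_rpow_of_nonpos hR0 hN1 (by linarith)
      _ = _ := by ring
  linarith

lemma one_dim_head (γ : ℝ) (h0 : 0 < γ) (hγ : γ < 1) : ∃ C : ℝ, 0 < C ∧ ∀ R : ℝ, 1 ≤ R →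
    ∀ s : Finset ℤ,
    ∑ k ∈ s, (if |(k : ℝ)| < R then (max 1 |(k : ℝ)|) ^ (-γ) else 0) ≤ C * R ^ (1 - γ) := by
  have hg : 0 < 1 - γ := by linarith
  refine ⟨2 * (1 + 2 / (1 - γ)), by positivity, fun R hR s => ?_⟩
  have hR0 : 0 < R := by linarith
  have hf : ∀ n : ℕ, 0 ≤ (if (n : ℝ) < R then (max 1 (n : ℝ)) ^ (-γ) else 0) := fun n => by
    split_ifs <;> positivity
  have := sum_int_le (fun n => if (n : ℝ) < R then (max 1 (n : ℝ)) ^ (-γ) else 0) hf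
    ((1 + 2 / (1 - γ)) * R ^ (1 - γ)) ?_ s
  · simp only [natAbs_real] at this
    linarith
  intro M
  set N := ⌈R⌉₊ with hNdef
  have hN1 : R ≤ N := Nat.le_ceil R
  have hN2 : (N : ℝ) < R + 1 := Nat.ceil_lt_add_one hR0.le
  have h1 : ∑ n ∈ Finset.range M, (if (n : ℝ) < R then (max 1 (n : ℝ)) ^ (-γ) else 0)
      ≤ ∑ n ∈ Finset.range (N + 1), (max 1 (n : ℝ)) ^ (-γ) := by
    rw [← Finset.sum_filter]
    refine Finset.sum_le_sum_of_subset_of_nonneg ?_ fun i _ _ => by positivity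
    intro n hn
    have h := (Finset.mem_filter.1 hn).2
    have : n < N := by exact_mod_cast h.trans_le hN1
    exact Finset.mem_range.2 (by omega)
  refine h1.trans ?_
  rw [Finset.sum_range_succ']
  have h2 : ∑ n ∈ Finset.range N, (max 1 ((n + 1 : ℕ) : ℝ)) ^ (-γ) ≤ 2 / (1 - γ) * R ^ (1 - γ) := by
    calc ∑ n ∈ Finset.range N, (max 1 ((n + 1 : ℕ) : ℝ)) ^ (-γ)
        = ∑ n ∈ Finset.range N, ((n : ℝ) + 1) ^ (-γ) := Finset.sum_congr rfl fun n _ => by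
          rw [max_eq_right]
          · push_cast; rfl
          · push_cast; linarith [Nat.cast_nonneg (α := ℝ) n]
      _ ≤ (N : ℝ) ^ (1 - γ) / (1 - γ) := sum_pos γ h0 hγ N
      _ ≤ (2 * R) ^ (1 - γ) / (1 - γ) := by gcongr; linarith
      _ ≤ (2 * R ^ (1 - γ)) / (1 - γ) := by
          gcongr
          rw [Real.mul_rpow (by norm_num) hR0.le]
          gcongr
          exact Real.rpow_le_self_of_one_le (by norm_num) (by linarith)
      _ = _ := by ring
  have h3 : (1 : ℝ) ≤ R ^ (1 - γ) := Real.one_le_rpow hR hg.le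
  have h4 : (max 1 ((0 : ℕ) : ℝ)) ^ (-γ) = 1 := by simp
  rw [h4]
  linarith

/-- Product structure: sums over boxes. -/
lemma sum_box_le {d : ℕ} (s : Fin d → Finset ℤ) (g : ℤ → ℝ) (hg : ∀ k, 0 ≤ g k) (D : ℝ)
    (hD : ∀ s : Finset ℤ, ∑ k ∈ s, g k ≤ D) :
    ∑ k ∈ Fintype.piFinset s, ∏ i, g (k i) ≤ D ^ d := by
  rw [← Finset.prod_univ_sum s (fun _ => g)]
  refine (Finset.prod_le_prod (fun i _ => Finset.sum_nonneg fun k _ => hg k)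
    (fun i _ => hD (s i))).trans ?_
  simp

lemma sum_fin_le {d : ℕ} (S : Finset (Fin d → ℤ)) (g : ℤ → ℝ) (hg : ∀ k, 0 ≤ g k) (D : ℝ)
    (hD : ∀ s : Finset ℤ, ∑ k ∈ s, g k ≤ D) :
    ∑ k ∈ S, ∏ i, g (k i) ≤ D ^ d := by
  refine le_trans (Finset.sum_le_sum_of_subset_of_nonneg ?_ fun k _ _ =>
    Finset.prod_nonneg fun i _ => hg _) (sum_box_le (fun i => S.image (fun k => k i)) g hg D hD)
  intro k hk
  exact Fintype.mem_piFinset.2 fun i => Finset.mem_image_of_mem _ hk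

lemma rpow_dim {d : ℕ} (hd : 1 ≤ d) (C R γ : ℝ) (hR : 0 < R) :
    (C * R ^ (1 - γ / d)) ^ d = C ^ d * R ^ ((d : ℝ) - γ) := by
  have : (d : ℝ) ≠ 0 := by positivity
  rw [mul_pow, ← Real.rpow_mul_natCast hR.le]
  congr 2
  field_simp

lemma rpow_split {d : ℕ} (hd : 1 ≤ d) (x γ : ℝ) (hx : 0 ≤ x) :
    x ^ (-γ) = ∏ _i : Fin d, x ^ (-(γ / d)) := by
  have : (d : ℝ) ≠ 0 := by positivity
  rw [Finset.prod_const, Finset.card_univ, Fintype.card_fin, ← Real.rpow_mul_natCast hx]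
  congr 1
  field_simp

lemma coord_le {d : ℕ} (k : Fin d → ℤ) (i : Fin d) : |(k i : ℝ)| ≤ ‖k‖ := by
  have := norm_le_pi_norm k i
  rwa [Int.norm_eq_abs] at this

lemma one_le_norm {d : ℕ} (k : Fin d → ℤ) (hk : k ≠ 0) : 1 ≤ ‖k‖ := by
  obtain ⟨i, hi⟩ := Function.ne_iff.1 hk
  refine le_trans ?_ (coord_le k i)
  have : 1 ≤ |k i| := Int.one_le_abs hi
  exact_mod_cast this

lemma norm_le_znorm {d : ℕ} (k : Fin d → ℤ) : ‖k‖ ≤ znorm k := by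
  refine (pi_norm_le_iff_of_nonneg (Real.sqrt_nonneg _)).2 fun i => ?_
  rw [Int.norm_eq_abs, ← Real.sqrt_sq_eq_abs]
  exact Real.sqrt_le_sqrt (Finset.single_le_sum (f := fun i => ((k i : ℝ)) ^ 2)
    (fun i _ => sq_nonneg _) (Finset.mem_univ i))

lemma znormSq_nonneg {d : ℕ} (k : Fin d → ℤ) : 0 ≤ znormSq k :=
  Finset.sum_nonneg fun i _ => sq_nonneg _

lemma znormSq_add_le {d : ℕ} (k m : Fin d → ℤ) :
    znormSq (k + m) ≤ 2 * (znormSq k + znormSq m) := by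
  unfold znormSq
  rw [← Finset.sum_add_distrib, Finset.mul_sum]
  refine Finset.sum_le_sum fun i _ => ?_
  push_cast [Pi.add_apply]
  nlinarith [sq_nonneg ((k i : ℝ) - m i)]

lemma head_bound (d : ℕ) (hd : 1 ≤ d) (α : ℝ) (h0 : 0 < α) (h2 : α < d) :
    ∃ C : ℝ, 0 < C ∧ ∀ R : ℝ, 1 ≤ R → ∀ S : Finset (Fin d → ℤ),
      ∑ k ∈ S, (if ‖k‖ < R then ‖k‖ ^ (-α) else 0) ≤ C * R ^ ((d : ℝ) - α) := by
  have hd0 : (0 : ℝ) < d := by positivity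
  obtain ⟨C, hC, h⟩ := one_dim_head (α / d) (by positivity) ((div_lt_one hd0).2 h2)
  refine ⟨C ^ d, by positivity, fun R hR S => ?_⟩
  rw [← rpow_dim hd C R α (by linarith)]
  have hg : ∀ k : ℤ, 0 ≤ (if |(k : ℝ)| < R then (max 1 |(k : ℝ)|) ^ (-(α / d)) else 0) := by
    intro k; split_ifs <;> positivity
  refine le_trans (Finset.sum_le_sum fun k _ => ?_) (sum_fin_le S _ hg _ (h R hR))
  by_cases hk : k = 0
  · refine le_trans (le_of_eq ?_) (Finset.prod_nonneg fun i _ => hg _)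
    simp [hk, Real.zero_rpow (neg_ne_zero.2 h0.ne')]
  split_ifs with hkR
  · rw [rpow_split hd _ _ (norm_nonneg k)]
    refine Finset.prod_le_prod (fun i _ => by positivity) fun i _ => ?_
    rw [if_pos ((coord_le k i).trans_lt hkR)]
    exact Real.rpow_le_rpow_of_nonpos (by positivity)
      (max_le (one_le_norm k hk) (coord_le k i)) (by rw [neg_nonpos]; positivity)
  · exact Finset.prod_nonneg fun i _ => hg _

lemma tail_bound (d : ℕ) (hd : 1 ≤ d) (β : ℝ) (h2 : d < β) :
    ∃ C : ℝ, 0 < C ∧ ∀ R : ℝ, 1 ≤ R → ∀ S : Finset (Fin d → ℤ),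
      ∑ k ∈ S, (if ‖k‖ < R then 0 else ‖k‖ ^ (-β)) ≤ C * R ^ ((d : ℝ) - β) := by
  have hd0 : (0 : ℝ) < d := by positivity
  have hβ : 0 < β := hd0.trans h2
  obtain ⟨C, hC, h⟩ := one_dim_tail (β / d) ((one_lt_div hd0).2 h2)
  refine ⟨C ^ d, by positivity, fun R hR S => ?_⟩
  have hR0 : 0 < R := by linarith
  rw [← rpow_dim hd C R β hR0]
  have hg : ∀ k : ℤ, 0 ≤ (max R |(k : ℝ)|) ^ (-(β / d)) := by
    intro k; positivity
  refine le_trans (Finset.sum_le_sum fun k _ => ?_) (sum_fin_le S _ hg _ (h R hR))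
  split_ifs with hkR
  · exact Finset.prod_nonneg fun i _ => hg _
  · rw [rpow_split hd _ _ (norm_nonneg k)]
    refine Finset.prod_le_prod (fun i _ => by positivity) fun i _ => ?_
    exact Real.rpow_le_rpow_of_nonpos (by positivity)
      (max_le (not_lt.1 hkR) (coord_le k i)) (by rw [neg_nonpos]; positivity)

lemma gauss_pt (R x : ℝ) (hR : 0 < R) :
    Real.exp (-(Real.pi ^ 2 * x ^ 2 / R ^ 2)) ≤ R ^ 2 * (max R |x|) ^ (-2 : ℝ) := by
  have hm : 0 < max R |x| := by positivity
  have e : (max R |x|) ^ (-2 : ℝ) = ((max R |x|) ^ 2)⁻¹ := by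
    rw [Real.rpow_neg hm.le]; norm_cast
  rw [e, ← div_eq_mul_inv, le_div_iff₀ (by positivity), Real.exp_neg, inv_mul_le_iff₀ (by positivity)]
  have h1 := Real.add_one_le_exp (Real.pi ^ 2 * x ^ 2 / R ^ 2)
  have h0 : 0 ≤ Real.pi ^ 2 * x ^ 2 / R ^ 2 := by positivity
  have hpi : 1 ≤ Real.pi ^ 2 := by nlinarith [Real.pi_gt_three]
  rcases max_cases R |x| with ⟨h, -⟩ | ⟨h, -⟩ <;> rw [h]
  · nlinarith [sq_nonneg R]
  · rw [sq_abs]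
    have h3 : Real.pi ^ 2 * x ^ 2 = Real.pi ^ 2 * x ^ 2 / R ^ 2 * R ^ 2 := by field_simp
    have h4 : x ^ 2 ≤ Real.pi ^ 2 * x ^ 2 := by nlinarith [sq_nonneg x]
    nlinarith [sq_nonneg R]

lemma gauss_bound (d : ℕ) :
    ∃ C : ℝ, 0 < C ∧ ∀ R : ℝ, 1 ≤ R → ∀ S : Finset (Fin d → ℤ),
      ∑ k ∈ S, Real.exp (-(Real.pi ^ 2 * znormSq k / R ^ 2)) ≤ C * R ^ (d : ℝ) := by
  obtain ⟨C, hC, h⟩ := one_dim_tail 2 (by norm_num)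
  refine ⟨C ^ d, by positivity, fun R hR S => ?_⟩
  have hR0 : 0 < R := by linarith
  rw [Real.rpow_natCast, ← mul_pow]
  refine le_trans (le_of_eq ?_) (sum_fin_le S
    (fun k : ℤ => Real.exp (-(Real.pi ^ 2 * (k : ℝ) ^ 2 / R ^ 2))) (fun _ => by positivity) _ ?_)
  · refine Finset.sum_congr rfl fun k _ => ?_
    rw [← Real.exp_sum]
    congr 1
    rw [znormSq, Finset.mul_sum, Finset.sum_div, Finset.sum_neg_distrib]
  · intro s
    refine (Finset.sum_le_sum fun (k : ℤ) _ => gauss_pt R (k : ℝ) hR0).trans ?_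
    rw [← Finset.mul_sum]
    refine (mul_le_mul_of_nonneg_left (h R hR s) (by positivity)).trans (le_of_eq ?_)
    have : R ^ (1 - 2 : ℝ) = R⁻¹ := by rw [← Real.rpow_neg_one]; norm_num
    rw [this]; field_simp

/-- Pointwise bound of the summand by the heat factor and sup norms. -/
lemma summand_le {d : ℕ} (α t u : ℝ) (hα : 0 < α) (hu0 : 0 ≤ u) (hu : u ≤ 2 * t)
    (k m : Fin d → ℤ) (hk : k ≠ 0) (hm : m ≠ 0) :
    Real.exp (-(Real.pi ^ 2 * znormSq (k + m) * (2 * t - u))) *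
      Real.exp (-(Real.pi ^ 2 * (znormSq k + znormSq m) * u)) / (znorm k ^ α * znorm m ^ α)
    ≤ Real.exp (-(Real.pi ^ 2 * znormSq (k + m) * t)) * (‖k‖ ^ (-α) * ‖m‖ ^ (-α)) := by
  have key : ∀ k : Fin d → ℤ, k ≠ 0 → (znorm k ^ α)⁻¹ ≤ ‖k‖ ^ (-α) := fun k hk => by
    have h1 := one_le_norm k hk
    have h2 := norm_le_znorm k
    rw [← Real.rpow_neg (by linarith)]
    exact Real.rpow_le_rpow_of_nonpos (by linarith) h2 (by linarith)
  have h0 : ∀ k : Fin d → ℤ, 0 ≤ (znorm k ^ α)⁻¹ := fun k =>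
    inv_nonneg.2 (Real.rpow_nonneg (Real.sqrt_nonneg _) _)
  rw [div_eq_mul_inv, mul_inv, ← Real.exp_add]
  refine mul_le_mul (Real.exp_le_exp.2 ?_)
    (mul_le_mul (key k hk) (key m hm) (h0 m) (by positivity))
    (mul_nonneg (h0 k) (h0 m)) (by positivity)
  have ha := znormSq_add_le k m
  have hn := znormSq_nonneg (k + m)
  have hp : 0 < Real.pi ^ 2 := by positivity
  have : znormSq (k + m) * t ≤ znormSq (k + m) * (2 * t - u) + (znormSq k + znormSq m) * u := by
    nlinarith
  nlinarith

/-- Pointwise splitting according to whether the norms are below or above `R`. -/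
lemma split_pt (K x y R α : ℝ) (hR : 0 < R) (hα : 0 < α) (hK0 : 0 ≤ K) (hK1 : K ≤ 1)
    (hx : 0 ≤ x) (hy : 0 ≤ y) :
    K * (x ^ (-α) * y ^ (-α)) ≤
      (if x < R then x ^ (-α) else 0) * (if y < R then y ^ (-α) else 0)
      + R ^ (-α) * ((if x < R then x ^ (-α) else 0) * K)
      + R ^ (-α) * ((if y < R then y ^ (-α) else 0) * K)
      + ((if x < R then 0 else x ^ (-(2 * α))) * K + (if y < R then 0 else y ^ (-(2 * α))) * K) := by
  have e : ∀ z : ℝ, 0 ≤ z → z ^ (-(2 * α)) = (z ^ (-α)) ^ 2 := fun z hz => by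
    rw [← Real.rpow_mul_natCast hz]; congr 1; push_cast; ring
  have hle : ∀ z : ℝ, ¬ z < R → z ^ (-α) ≤ R ^ (-α) := fun z hz =>
    Real.rpow_le_rpow_of_nonpos hR (not_lt.1 hz) (by linarith)
  have hxa : 0 ≤ x ^ (-α) := by positivity
  have hya : 0 ≤ y ^ (-α) := by positivity
  have hRa : 0 ≤ R ^ (-α) := by positivity
  rw [e x hx, e y hy]
  have hxy := mul_nonneg hxa hya
  split_ifs with h1 h2 h2
  · have a1 := mul_le_mul_of_nonneg_right hK1 hxy
    have a2 : 0 ≤ R ^ (-α) * (x ^ (-α) * K) := by positivity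
    have a3 : 0 ≤ R ^ (-α) * (y ^ (-α) * K) := by positivity
    linarith
  · have a1 := mul_le_mul_of_nonneg_right (hle y h2) (mul_nonneg hxa hK0)
    have a2 : 0 ≤ (y ^ (-α)) ^ 2 * K := by positivity
    linarith
  · have a1 := mul_le_mul_of_nonneg_right (hle x h1) (mul_nonneg hya hK0)
    have a2 : 0 ≤ (x ^ (-α)) ^ 2 * K := by positivity
    linarith
  · have a1 := mul_nonneg hK0 (sq_nonneg (x ^ (-α) - y ^ (-α)))
    have a2 := mul_nonneg hK0 hxy
    nlinarith

lemma sum_shift_bound {d : ℕ} (S : Finset (Fin d → ℤ)) (K P : (Fin d → ℤ) → ℝ) (A B : ℝ)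
    (hP : ∀ k, 0 ≤ P k) (hA : ∑ k ∈ S, P k ≤ A) (hB0 : 0 ≤ B)
    (hB : ∀ S : Finset (Fin d → ℤ), ∑ k ∈ S, K k ≤ B) :
    ∑ k ∈ S, ∑ m ∈ S, P k * K (k + m) ≤ A * B := by
  calc ∑ k ∈ S, ∑ m ∈ S, P k * K (k + m) ≤ ∑ k ∈ S, P k * B := by
        refine Finset.sum_le_sum fun k _ => ?_
        rw [← Finset.mul_sum]
        refine mul_le_mul_of_nonneg_left ?_ (hP k)
        have := hB (S.map (addLeftEmbedding k))
        rwa [Finset.sum_map] at this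
    _ = (∑ k ∈ S, P k) * B := by rw [Finset.sum_mul]
    _ ≤ A * B := mul_le_mul_of_nonneg_right hA hB0

lemma box_bound (d : ℕ) (hd : 1 ≤ d) (α : ℝ) (h1 : (d : ℝ) / 2 < α) (h2 : α < d) :
    ∃ C : ℝ, 0 < C ∧ ∀ R : ℝ, 1 ≤ R → ∀ S : Finset (Fin d → ℤ),
      ∑ k ∈ S, ∑ m ∈ S, Real.exp (-(Real.pi ^ 2 * znormSq (k + m) / R ^ 2)) *
        (‖k‖ ^ (-α) * ‖m‖ ^ (-α)) ≤ C * R ^ (2 * ((d : ℝ) - α)) := by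
  have hd0 : (0 : ℝ) < d := by positivity
  have hα : 0 < α := by linarith
  obtain ⟨A, hA, hP⟩ := head_bound d hd α hα h2
  obtain ⟨B, hB, hQ⟩ := tail_bound d hd (2 * α) (by linarith)
  obtain ⟨G, hG, hK⟩ := gauss_bound d
  refine ⟨A * A + 2 * (A * G) + 2 * (B * G), by positivity, fun R hR S => ?_⟩
  have hR0 : 0 < R := by linarith
  set P : (Fin d → ℤ) → ℝ := fun k => if ‖k‖ < R then ‖k‖ ^ (-α) else 0 with hPdef
  set Q : (Fin d → ℤ) → ℝ := fun k => if ‖k‖ < R then 0 else ‖k‖ ^ (-(2 * α)) with hQdef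
  set K : (Fin d → ℤ) → ℝ := fun k => Real.exp (-(Real.pi ^ 2 * znormSq k / R ^ 2)) with hKdef
  have hP0 : ∀ k, 0 ≤ P k := fun k => by simp only [hPdef]; split_ifs <;> positivity
  have hQ0 : ∀ k, 0 ≤ Q k := fun k => by simp only [hQdef]; split_ifs <;> positivity
  have hPS := hP R hR S
  have hQS := hQ R hR S
  have hKS := hK R hR
  have hpt : ∀ k m, K (k + m) * (‖k‖ ^ (-α) * ‖m‖ ^ (-α)) ≤
      P k * P m + R ^ (-α) * (P k * K (k + m)) + R ^ (-α) * (P m * K (k + m))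
      + (Q k * K (k + m) + Q m * K (k + m)) := fun k m => by
    refine split_pt (K (k + m)) ‖k‖ ‖m‖ R α hR0 hα (Real.exp_pos _).le ?_
      (norm_nonneg _) (norm_nonneg _)
    refine Real.exp_le_one_iff.2 ?_
    have := znormSq_nonneg (k + m)
    rw [neg_nonpos]; positivity
  have sP := sum_shift_bound S K P _ _ hP0 hPS (by positivity) hKS
  have sQ := sum_shift_bound S K Q _ _ hQ0 hQS (by positivity) hKS
  have sP' : ∑ k ∈ S, ∑ m ∈ S, P m * K (k + m) = ∑ k ∈ S, ∑ m ∈ S, P k * K (k + m) := by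
    rw [Finset.sum_comm]; simp only [add_comm]
  have sQ' : ∑ k ∈ S, ∑ m ∈ S, Q m * K (k + m) = ∑ k ∈ S, ∑ m ∈ S, Q k * K (k + m) := by
    rw [Finset.sum_comm]; simp only [add_comm]
  have sPP : ∑ k ∈ S, ∑ m ∈ S, P k * P m ≤
      (A * R ^ ((d : ℝ) - α)) * (A * R ^ ((d : ℝ) - α)) := by
    rw [← Finset.sum_mul_sum]
    exact mul_le_mul hPS hPS (Finset.sum_nonneg fun k _ => hP0 k) (by positivity)
  refine (Finset.sum_le_sum fun k _ => Finset.sum_le_sum fun m _ => hpt k m).trans ?_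
  simp only [Finset.sum_add_distrib, ← Finset.mul_sum]
  simp only [← Finset.mul_sum] at sP sQ sP' sQ' sPP
  rw [sP', sQ']
  have e1 : R ^ ((d : ℝ) - α) * R ^ ((d : ℝ) - α) = R ^ (2 * ((d : ℝ) - α)) := by
    rw [← Real.rpow_add hR0]; ring_nf
  have e2 : R ^ (-α) * (R ^ ((d : ℝ) - α) * R ^ (d : ℝ)) = R ^ (2 * ((d : ℝ) - α)) := by
    rw [← Real.rpow_add hR0, ← Real.rpow_add hR0]; ring_nf
  have e3 : R ^ ((d : ℝ) - 2 * α) * R ^ (d : ℝ) = R ^ (2 * ((d : ℝ) - α)) := by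
    rw [← Real.rpow_add hR0]; ring_nf
  have sP2 := mul_le_mul_of_nonneg_left sP (show 0 ≤ R ^ (-α) by positivity)
  have f1 : (A * R ^ ((d : ℝ) - α)) * (A * R ^ ((d : ℝ) - α))
      = A * A * R ^ (2 * ((d : ℝ) - α)) := by rw [← e1]; ring
  have f2 : R ^ (-α) * (A * R ^ ((d : ℝ) - α) * (G * R ^ (d : ℝ)))
      = A * G * R ^ (2 * ((d : ℝ) - α)) := by rw [← e2]; ring
  have f3 : B * R ^ ((d : ℝ) - 2 * α) * (G * R ^ (d : ℝ))
      = B * G * R ^ (2 * ((d : ℝ) - α)) := by rw [← e3]; ring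
  rw [f1] at sPP
  rw [f2] at sP2
  rw [f3] at sQ
  linarith

/-- For `d ≥ 1`, `α ∈ (d/2, d)`, there is `C = C(d, α)` such that for `t ∈ (0,1]` and
`u ∈ [0, 2t]`, the double sum over nonzero `n¹, n² ∈ ℤ^d` of
`e^{-π²|n¹+n²|²(2t-u)} e^{-π²(|n¹|²+|n²|²)u} / (|n¹|^α |n²|^α)` is at most `C t^{-(d-α)}`. -/
theorem double_sum_heat_bound (d : ℕ) (hd : 1 ≤ d) (α : ℝ) (h1 : (d : ℝ) / 2 < α)
    (h2 : α < d) :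
    ∃ C : ℝ, 0 < C ∧ ∀ t u : ℝ, 0 < t → t ≤ 1 → 0 ≤ u → u ≤ 2 * t →
      (∑' p : {p : (Fin d → ℤ) × (Fin d → ℤ) // p.1 ≠ 0 ∧ p.2 ≠ 0},
          Real.exp (-(Real.pi ^ 2 * znormSq (p.1.1 + p.1.2) * (2 * t - u))) *
            Real.exp (-(Real.pi ^ 2 * (znormSq p.1.1 + znormSq p.1.2) * u)) /
            (znorm p.1.1 ^ α * znorm p.1.2 ^ α))
        ≤ C * t ^ (-((d : ℝ) - α)) := by
  have hd0 : (0 : ℝ) < d := by positivity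
  have hα : 0 < α := by linarith
  obtain ⟨C, hC, hbox⟩ := box_bound d hd α h1 h2
  refine ⟨C, hC, fun t u ht ht1 hu0 hu => ?_⟩
  have hR : 1 ≤ t ^ (-(1 / 2) : ℝ) := Real.one_le_rpow_of_pos_of_le_one_of_nonpos ht ht1 (by norm_num)
  have hRt : (t ^ (-(1 / 2) : ℝ)) ^ 2 = t⁻¹ := by
    rw [← Real.rpow_mul_natCast ht.le, ← Real.rpow_neg_one]; norm_num
  have hRe : (t ^ (-(1 / 2) : ℝ)) ^ (2 * ((d : ℝ) - α)) = t ^ (-((d : ℝ) - α)) := by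
    rw [← Real.rpow_mul ht.le]; ring_nf
  refine Real.tsum_le_of_sum_le (fun p => ?_) fun U => ?_
  · exact div_nonneg (by positivity) (mul_nonneg (Real.rpow_nonneg (Real.sqrt_nonneg _) _)
      (Real.rpow_nonneg (Real.sqrt_nonneg _) _))
  classical
  set V := U.map (Function.Embedding.subtype _) with hV
  set S := V.image Prod.fst ∪ V.image Prod.snd with hS
  have := hbox _ hR S
  rw [hRe, hRt, ← Finset.sum_product' S S (fun k m =>
    Real.exp (-(Real.pi ^ 2 * znormSq (k + m) / t⁻¹)) * (‖k‖ ^ (-α) * ‖m‖ ^ (-α)))] at this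
  refine le_trans ?_ this
  have hsub : V ⊆ S ×ˢ S := fun p hp => Finset.mem_product.2
    ⟨Finset.mem_union_left _ (Finset.mem_image_of_mem _ hp),
      Finset.mem_union_right _ (Finset.mem_image_of_mem _ hp)⟩
  refine le_trans ?_ (Finset.sum_le_sum_of_subset_of_nonneg hsub fun p _ _ => by positivity)
  rw [hV, Finset.sum_map]
  refine Finset.sum_le_sum fun p _ => ?_
  have h := summand_le α t u hα hu0 hu p.1.1 p.1.2 p.2.1 p.2.2
  rw [div_inv_eq_mul]
  exact h
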